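/- Fix a real p ≥ 1 and set s_n = (n + 1/2) − (n + 1/2)^{2/3} for integers n ≥ 1. There exists a constant C̃_p > 0 depending only on p such that for every sufficiently large integer n and every positive zero α of the spherical Bessel function j_n, one has ( ∫_0^{s_n} z² |j_n(z)|^p dz / ∫_0^{α} z² |j_n(z)|^p dz )^{1/p} < C̃_p · (n + 1/2)^{1/3 + 2/(3p)} · exp(−(1/3)(n + 1/2)^{1/3}). Moreover, for each fixed k ≥ 1, this quantity with α = γ_{n,k} tends to 0 as n → ∞, while (s_n / γ_{n,k})³ tends to 1 as n → ∞. (The displayed ratio equals the ratio ‖u_{n,k}‖_{L_p(B_{n,k})}/‖u_{n,k}‖_{L_p(B)} for the Dirichlet Laplacian eigenfunctions of the ball B of radius R, where B_{n,k} is the concentric ball of radius R·s_n/γ_{n,k}.) -/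

import Mathlib

open Real MeasureTheory Filter Topology

/-- The Bessel function of the first kind of order `ν`. -/
noncomputable def besselJ (ν : ℝ) (x : ℝ) : ℝ :=
  ∑' k : ℕ, ((-1 : ℝ) ^ k / ((k.factorial : ℝ) * Real.Gamma ((k : ℝ) + ν + 1))) *
    (x / 2) ^ (2 * (k : ℝ) + ν)

/-- The spherical Bessel function `j_n(x) = √(π/(2x)) J_{n+1/2}(x)`. -/
noncomputable def sbesselJ (n : ℕ) (x : ℝ) : ℝ :=
  Real.sqrt (π / (2 * x)) * besselJ ((n : ℝ) + 1 / 2) x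

/-- `s_n = (n + 1/2) - (n + 1/2)^{2/3}`. -/
noncomputable def sseq (n : ℕ) : ℝ := ((n : ℝ) + 1 / 2) - ((n : ℝ) + 1 / 2) ^ ((2 : ℝ) / 3)

/-- The ratio `( ∫_0^{s_n} z² |j_n(z)|^p dz / ∫_0^α z² |j_n(z)|^p dz )^{1/p}`, which equals
`‖u_{n,k}‖_{L_p(B_{n,k})}/‖u_{n,k}‖_{L_p(B)}` for the ball eigenfunctions. -/
noncomputable def ballRatio (p : ℝ) (n : ℕ) (α : ℝ) : ℝ :=
  ((∫ z in (0 : ℝ)..sseq n, z ^ 2 * |sbesselJ n z| ^ p) /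
    (∫ z in (0 : ℝ)..α, z ^ 2 * |sbesselJ n z| ^ p)) ^ (1 / p)


/-- The entire part of the Bessel function. -/
noncomputable def besG (ν : ℝ) (y : ℝ) : ℝ :=
  ∑' k : ℕ, ((-1 : ℝ) ^ k / ((k.factorial : ℝ) * Real.Gamma ((k : ℝ) + ν + 1))) * y ^ k

lemma one_le_Gamma_aux {x : ℝ} (hx : 2 ≤ x) : 1 ≤ Real.Gamma x := by
  have h := Real.Gamma_strictMonoOn_Ici.monotoneOn (Set.mem_Ici.2 le_rfl) (Set.mem_Ici.2 hx) hx
  rwa [Real.Gamma_two] at h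

lemma besG_term_bound {ν : ℝ} (hν : 1 ≤ ν) (y : ℝ) (k : ℕ) :
    ‖((-1 : ℝ) ^ k / ((k.factorial : ℝ) * Real.Gamma ((k : ℝ) + ν + 1))) * y ^ k‖
      ≤ |y| ^ k / k.factorial := by
  have hk : (0 : ℝ) ≤ k := Nat.cast_nonneg k
  have hG : 1 ≤ Real.Gamma ((k : ℝ) + ν + 1) := one_le_Gamma_aux (by linarith)
  have hf : (0 : ℝ) < k.factorial := by exact_mod_cast k.factorial_pos
  rw [norm_mul, norm_div, norm_pow, norm_pow, norm_neg, norm_one, one_pow, norm_mul,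
    Real.norm_eq_abs, Real.norm_eq_abs, Real.norm_eq_abs, abs_of_pos hf,
    abs_of_pos (by linarith : 0 < Real.Gamma ((k : ℝ) + ν + 1)), div_mul_eq_mul_div, one_mul]
  apply div_le_div_of_nonneg_left (by positivity) hf
  nlinarith

lemma besG_summable {ν : ℝ} (hν : 1 ≤ ν) (y : ℝ) :
    Summable (fun k : ℕ =>
      ((-1 : ℝ) ^ k / ((k.factorial : ℝ) * Real.Gamma ((k : ℝ) + ν + 1))) * y ^ k) :=
  Summable.of_norm_bounded (Real.summable_pow_div_factorial |y|) (besG_term_bound hν y)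

lemma besG_hasDerivAt {ν : ℝ} (hν : 1 ≤ ν) (y : ℝ) :
    HasDerivAt (besG ν) (-besG (ν + 1) y) y := by
  set a : ℕ → ℝ := fun k => (-1 : ℝ) ^ k / ((k.factorial : ℝ) * Real.Gamma ((k : ℝ) + ν + 1))
    with ha
  set R : ℝ := |y| + 1 with hR
  have hR0 : 0 < R := by positivity
  have hshift : ∀ (k : ℕ) (x : ℝ), a (k + 1) * (((k + 1 : ℕ) : ℝ) * x ^ k) =
      -(((-1 : ℝ) ^ k / ((k.factorial : ℝ) * Real.Gamma ((k : ℝ) + (ν + 1) + 1))) * x ^ k) := by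
    intro k x
    have hf : (0 : ℝ) < k.factorial := by exact_mod_cast k.factorial_pos
    have hk : (0 : ℝ) ≤ k := Nat.cast_nonneg k
    have hG : 1 ≤ Real.Gamma ((k : ℝ) + (ν + 1) + 1) := one_le_Gamma_aux (by linarith)
    simp only [ha]
    have e : ((k + 1 : ℕ) : ℝ) + ν + 1 = (k : ℝ) + (ν + 1) + 1 := by push_cast; ring
    rw [e, Nat.factorial_succ, pow_succ]
    have : Real.Gamma ((k : ℝ) + (ν + 1) + 1) ≠ 0 := by linarith
    push_cast
    field_simp
  have hu : Summable (fun k : ℕ => (k : ℝ) * R ^ (k - 1) / k.factorial) := by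
    rw [← summable_nat_add_iff 1]
    refine (Real.summable_pow_div_factorial R).congr ?_
    intro k
    have hf : (0 : ℝ) < k.factorial := by exact_mod_cast k.factorial_pos
    rw [Nat.factorial_succ]
    push_cast
    field_simp
  have key := hasDerivAt_tsum_of_isPreconnected (g := fun k x => a k * x ^ k)
    (g' := fun k x => a k * ((k : ℝ) * x ^ (k - 1))) (t := Metric.ball 0 R) (y₀ := y) (y := y)
    hu Metric.isOpen_ball (convex_ball 0 R).isPreconnected
    (fun k x _ => (hasDerivAt_pow k x).const_mul (a k))
    (by
      intro k x hx
      rw [mem_ball_zero_iff, Real.norm_eq_abs] at hx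
      have hk : (0 : ℝ) ≤ k := Nat.cast_nonneg k
      have hG : 1 ≤ Real.Gamma ((k : ℝ) + ν + 1) := one_le_Gamma_aux (by linarith)
      have hf : (0 : ℝ) < k.factorial := by exact_mod_cast k.factorial_pos
      have h1 : |a k| ≤ 1 / k.factorial := by
        have := besG_term_bound hν 1 k
        simpa only [ha, one_pow, mul_one, abs_one, Real.norm_eq_abs] using this
      rw [norm_mul, norm_mul, norm_pow, Real.norm_eq_abs, Real.norm_eq_abs, Real.norm_eq_abs,
        abs_of_nonneg hk]
      calc |a k| * (k * |x| ^ (k - 1)) ≤ 1 / k.factorial * (k * R ^ (k - 1)) := by gcongr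
        _ = _ := by ring)
    (by rw [mem_ball_zero_iff, Real.norm_eq_abs]; linarith)
    (besG_summable hν y)
    (by rw [mem_ball_zero_iff, Real.norm_eq_abs]; linarith)
  have e : ∑' k : ℕ, a k * ((k : ℝ) * y ^ (k - 1)) = -besG (ν + 1) y := by
    have hs : Summable (fun k : ℕ => a (k + 1) * (((k + 1 : ℕ) : ℝ) * y ^ k)) := by
      simp only [hshift]
      exact (besG_summable (by linarith) y).neg
    have h2 := ((summable_nat_add_iff 1 (f := fun k : ℕ => a k * ((k : ℝ) * y ^ (k - 1)))).1
      (by simpa using hs)).tsum_eq_zero_add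
    rw [h2]
    simp only [Nat.add_sub_cancel, hshift, Nat.cast_zero, zero_mul, mul_zero, zero_add]
    rw [tsum_neg, besG]
  rw [e] at key
  exact key

lemma besG_rec {ν : ℝ} (hν : 1 ≤ ν) (y : ℝ) :
    besG ν y = (ν + 1) * besG (ν + 1) y - y * besG (ν + 2) y := by
  have s1 := besG_summable (ν := ν + 1) (by linarith) y
  have s2 := besG_summable (ν := ν + 2) (by linarith) y
  have s0 := besG_summable hν y
  have h0 : besG ν y - (ν + 1) * besG (ν + 1) y = - (y * besG (ν + 2) y) := by
    unfold besG
    rw [← tsum_mul_left, ← tsum_mul_left, ← s0.tsum_sub (s1.mul_left _), ← tsum_neg,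
      (s0.sub (s1.mul_left _)).tsum_eq_zero_add]
    have z : Real.Gamma (ν + 1 + 1) = (ν + 1) * Real.Gamma (ν + 1) :=
      Real.Gamma_add_one (by linarith)
    have hG : 1 ≤ Real.Gamma (ν + 1) := one_le_Gamma_aux (by linarith)
    have z0 : ((-1 : ℝ) ^ 0 / ((Nat.factorial 0 : ℝ) * Real.Gamma (((0 : ℕ) : ℝ) + ν + 1))) * y ^ 0
      - (ν + 1) * (((-1 : ℝ) ^ 0 /
        ((Nat.factorial 0 : ℝ) * Real.Gamma (((0 : ℕ) : ℝ) + (ν + 1) + 1))) * y ^ 0) = 0 := by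
      have : Real.Gamma (ν + 1) ≠ 0 := by linarith
      have : ν + 1 ≠ 0 := by linarith
      simp [z]
      field_simp
      ring
    rw [z0, zero_add]
    congr 1
    funext k
    have hf : (0 : ℝ) < k.factorial := by exact_mod_cast k.factorial_pos
    have hk : (0 : ℝ) ≤ k := Nat.cast_nonneg k
    have hG1 : 1 ≤ Real.Gamma ((k : ℝ) + ν + 2) := one_le_Gamma_aux (by linarith)
    have e1 : (((k + 1 : ℕ) : ℝ) + ν + 1) = (k : ℝ) + ν + 2 := by push_cast; ring
    have e2 : (((k + 1 : ℕ) : ℝ) + (ν + 1) + 1) = ((k : ℝ) + ν + 2) + 1 := by push_cast; ring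
    have e3 : ((k : ℝ) + (ν + 2) + 1) = ((k : ℝ) + ν + 2) + 1 := by push_cast; ring
    rw [e1, e2, e3, Real.Gamma_add_one (by linarith), Nat.factorial_succ, pow_succ, pow_succ]
    have h1 : Real.Gamma ((k : ℝ) + ν + 2) ≠ 0 := by linarith
    have h2 : (k : ℝ) + ν + 2 ≠ 0 := by linarith
    push_cast
    field_simp
    ring
  linarith

lemma besG_zero_pos {ν : ℝ} (hν : 1 ≤ ν) : 0 < besG ν 0 := by
  unfold besG
  rw [tsum_eq_single 0 (by intro k hk; simp [hk])]
  have hG : 1 ≤ Real.Gamma (ν + 1) := one_le_Gamma_aux (by linarith)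
  simp
  linarith

/-- `z ↦ z^n G(z²/4)`. -/
noncomputable def besH (n : ℕ) (z : ℝ) : ℝ := z ^ n * besG ((n : ℝ) + 1 / 2) (z ^ 2 / 4)

lemma sbesselJ_eq {n : ℕ} (hn : 1 ≤ n) {z : ℝ} (hz : 0 ≤ z) :
    sbesselJ n z = (Real.sqrt π / 2 / 2 ^ n) * besH n z := by
  rcases hz.eq_or_lt with rfl | hz
  · simp [sbesselJ, besH, Nat.one_le_iff_ne_zero.1 hn]
  · unfold sbesselJ besH besselJ besG
    have h2 : (0 : ℝ) < z / 2 := by linarith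
    have e : ∀ k : ℕ, (z / 2) ^ (2 * (k : ℝ) + ((n : ℝ) + 1 / 2)) =
        (z / 2) ^ n * Real.sqrt (z / 2) * (z ^ 2 / 4) ^ k := by
      intro k
      rw [Real.rpow_add h2, Real.rpow_add h2, Real.rpow_natCast, ← Real.sqrt_eq_rpow]
      have : (2 * (k : ℝ)) = ((2 * k : ℕ) : ℝ) := by push_cast; ring
      rw [this, Real.rpow_natCast, pow_mul]
      have : (z / 2) ^ 2 = z ^ 2 / 4 := by ring
      rw [this]; ring
    simp only [e]
    have e2 : Real.sqrt (π / (2 * z)) * Real.sqrt (z / 2) = Real.sqrt π / 2 := by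
      rw [← Real.sqrt_mul (by positivity)]
      have : π / (2 * z) * (z / 2) = π / 2 ^ 2 := by field_simp
      rw [this, Real.sqrt_div (by positivity), Real.sqrt_sq (by norm_num)]
    have e3 : ∀ k : ℕ, ((-1 : ℝ) ^ k / ((k.factorial : ℝ) *
        Real.Gamma ((k : ℝ) + ((n : ℝ) + 1 / 2) + 1))) *
        ((z / 2) ^ n * Real.sqrt (z / 2) * (z ^ 2 / 4) ^ k) =
        ((z / 2) ^ n * Real.sqrt (z / 2)) * (((-1 : ℝ) ^ k / ((k.factorial : ℝ) *
        Real.Gamma ((k : ℝ) + ((n : ℝ) + 1 / 2) + 1))) * (z ^ 2 / 4) ^ k) := by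
      intro k; ring
    simp only [e3]
    rw [tsum_mul_left, div_pow, ← e2]
    ring

lemma besG_comp_hasDerivAt {ν : ℝ} (hν : 1 ≤ ν) (z : ℝ) :
    HasDerivAt (fun z : ℝ => besG ν (z ^ 2 / 4)) (-besG (ν + 1) (z ^ 2 / 4) * (z / 2)) z := by
  have h : HasDerivAt (fun z : ℝ => z ^ 2 / 4) (z / 2) z := by
    have := (hasDerivAt_pow 2 z).div_const 4
    exact this.congr_deriv (by push_cast; ring)
  exact (besG_hasDerivAt hν (z ^ 2 / 4)).comp z h

/-- The function z squared times the derivative of H. -/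
noncomputable def besP (n : ℕ) (z : ℝ) : ℝ :=
  n * z ^ (n + 1) * besG ((n : ℝ) + 1 / 2) (z ^ 2 / 4)
    - z ^ (n + 3) / 2 * besG ((n : ℝ) + 1 / 2 + 1) (z ^ 2 / 4)

/-- The derivative of z H. -/
noncomputable def besV (n : ℕ) (z : ℝ) : ℝ :=
  (n + 1) * z ^ n * besG ((n : ℝ) + 1 / 2) (z ^ 2 / 4)
    - z ^ (n + 2) / 2 * besG ((n : ℝ) + 1 / 2 + 1) (z ^ 2 / 4)

lemma nu_one_le {n : ℕ} (hn : 1 ≤ n) : (1 : ℝ) ≤ (n : ℝ) + 1 / 2 := by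
  have : (1 : ℝ) ≤ n := by exact_mod_cast hn
  linarith

lemma besH_hasDerivAt {n : ℕ} (hn : 1 ≤ n) {z : ℝ} (hz : z ≠ 0) :
    HasDerivAt (besH n) (besP n z / z ^ 2) z := by
  have h := (hasDerivAt_pow n z).mul (besG_comp_hasDerivAt (nu_one_le hn) z)
  refine h.congr_deriv ?_
  obtain ⟨m, rfl⟩ : ∃ m, n = m + 1 := ⟨n - 1, by omega⟩
  unfold besP
  simp only [Nat.add_sub_cancel]
  field_simp
  push_cast
  ring

lemma besH_continuous {n : ℕ} (hn : 1 ≤ n) : Continuous (besH n) := by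
  refine (continuous_pow n).mul ?_
  exact continuous_iff_continuousAt.2 fun z =>
    (besG_comp_hasDerivAt (nu_one_le hn) z).continuousAt

lemma besP_hasDerivAt {n : ℕ} (hn : 1 ≤ n) (z : ℝ) :
    HasDerivAt (besP n) ((n * (n + 1) - z ^ 2) * besH n z) z := by
  have hν := nu_one_le hn
  have h := (((hasDerivAt_pow (n + 1) z).const_mul (n : ℝ)).mul (besG_comp_hasDerivAt hν z)).sub
    (((hasDerivAt_pow (n + 3) z).div_const 2).mul
      (besG_comp_hasDerivAt (ν := (n : ℝ) + 1 / 2 + 1) (by linarith) z))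
  refine h.congr_deriv ?_
  unfold besH
  have r := besG_rec hν (z ^ 2 / 4)
  have e : (n : ℝ) + 1 / 2 + 1 + 1 = (n : ℝ) + 1 / 2 + 2 := by ring
  rw [e]
  have e1 : n + 1 - 1 = n := by omega
  have e2 : n + 3 - 1 = n + 2 := by omega
  rw [e1, e2]
  push_cast
  linear_combination (z ^ (n + 2)) * r

lemma besU_hasDerivAt {n : ℕ} (hn : 1 ≤ n) (z : ℝ) :
    HasDerivAt (fun z => z * besH n z) (besV n z) z := by
  have h := (hasDerivAt_id z).mul
    ((hasDerivAt_pow n z).mul (besG_comp_hasDerivAt (nu_one_le hn) z))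
  refine h.congr_deriv ?_
  obtain ⟨m, rfl⟩ : ∃ m, n = m + 1 := ⟨n - 1, by omega⟩
  unfold besV
  simp only [Nat.add_sub_cancel, id, Pi.mul_apply]
  push_cast
  ring

lemma besV_hasDerivAt {n : ℕ} (hn : 1 ≤ n) {z : ℝ} (hz : z ≠ 0) :
    HasDerivAt (besV n) ((n * (n + 1) / z ^ 2 - 1) * (z * besH n z)) z := by
  have hν := nu_one_le hn
  have h := (((hasDerivAt_pow n z).const_mul ((n : ℝ) + 1)).mul (besG_comp_hasDerivAt hν z)).sub
    (((hasDerivAt_pow (n + 2) z).div_const 2).mul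
      (besG_comp_hasDerivAt (ν := (n : ℝ) + 1 / 2 + 1) (by linarith) z))
  refine h.congr_deriv ?_
  unfold besH
  have r := besG_rec hν (z ^ 2 / 4)
  have e : (n : ℝ) + 1 / 2 + 1 + 1 = (n : ℝ) + 1 / 2 + 2 := by ring
  rw [e]
  have e2 : n + 2 - 1 = n + 1 := by omega
  rw [e2]
  have e3 : ((n : ℝ) * (n + 1) / z ^ 2 - 1) * (z * (z ^ n * besG ((n : ℝ) + 1 / 2) (z ^ 2 / 4)))
     = n * (n + 1) * z ^ (n - 1) * besG ((n : ℝ) + 1 / 2) (z ^ 2 / 4)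
       - z ^ (n + 1) * besG ((n : ℝ) + 1 / 2) (z ^ 2 / 4) := by
    obtain ⟨m, rfl⟩ : ∃ m, n = m + 1 := ⟨n - 1, by omega⟩
    simp only [Nat.add_sub_cancel]
    field_simp
    ring
  rw [e3]
  push_cast
  linear_combination (z ^ (n + 1)) * r

lemma besHP_mono {n : ℕ} (hn : 1 ≤ n) {b : ℝ} (hb : 0 ≤ b) (hb2 : b ^ 2 ≤ n * (n + 1))
    (hH : ∀ x ∈ Set.Ioo 0 b, 0 ≤ besH n x) :
    MonotoneOn (besH n) (Set.Icc 0 b) ∧ ∀ x ∈ Set.Icc 0 b, 0 ≤ besP n x := by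
  have hP : MonotoneOn (besP n) (Set.Icc 0 b) := by
    refine monotoneOn_of_hasDerivWithinAt_nonneg (convex_Icc 0 b)
      (f' := fun z => (n * (n + 1) - z ^ 2) * besH n z)
      (fun x _ => (besP_hasDerivAt hn x).continuousAt.continuousWithinAt)
      (fun x _ => (besP_hasDerivAt hn x).hasDerivWithinAt) ?_
    intro x hx
    rw [interior_Icc] at hx
    have : x ^ 2 ≤ b ^ 2 := by
      have := hx.1; have := hx.2
      gcongr
    exact mul_nonneg (by linarith) (hH x hx)
  have hP0 : besP n 0 = 0 := by simp [besP]
  have hPn : ∀ x ∈ Set.Icc 0 b, 0 ≤ besP n x := by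
    intro x hx
    rw [← hP0]
    exact hP (Set.left_mem_Icc.2 hb) hx hx.1
  refine ⟨?_, hPn⟩
  refine monotoneOn_of_hasDerivWithinAt_nonneg (convex_Icc 0 b)
      (f' := fun z => besP n z / z ^ 2) (besH_continuous hn).continuousOn ?_ ?_
  · intro x hx
    rw [interior_Icc] at hx
    exact (besH_hasDerivAt hn hx.1.ne').hasDerivWithinAt
  · intro x hx
    exact div_nonneg (hPn x (interior_subset hx)) (by positivity)

lemma besH_pos {n : ℕ} (hn : 1 ≤ n) {z : ℝ} (hz : 0 < z) (hz2 : z ^ 2 ≤ n * (n + 1)) :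
    0 < besH n z := by
  by_contra hcon
  push Not at hcon
  set g : ℝ → ℝ := fun z => besG ((n : ℝ) + 1 / 2) (z ^ 2 / 4) with hg
  have hgc : Continuous g := continuous_iff_continuousAt.2 fun z =>
    (besG_comp_hasDerivAt (nu_one_le hn) z).continuousAt
  have hHg : ∀ x, besH n x = x ^ n * g x := fun x => rfl
  have hg0 : 0 < g 0 := by
    have := besG_zero_pos (nu_one_le hn)
    simpa [hg] using this
  have hgz : g z ≤ 0 := by
    by_contra h
    push Not at h
    rw [hHg] at hcon
    have : 0 < z ^ n * g z := by positivity
    linarith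
  have hS : IsCompact (Set.Icc 0 z ∩ {x | g x ≤ 0}) :=
    isCompact_Icc.inter_right (isClosed_le hgc continuous_const)
  obtain ⟨x0, hx0, hleast⟩ := hS.exists_isLeast ⟨z, ⟨hz.le, le_rfl⟩, hgz⟩
  have hx0p : 0 < x0 := by
    rcases hx0.1.1.eq_or_lt with h | h
    · exfalso
      have := hx0.2
      rw [← h] at this
      simp only [Set.mem_setOf_eq] at this
      linarith
    · exact h
  have hpos : ∀ x ∈ Set.Ioo 0 x0, 0 < besH n x := by
    intro x hx
    have : 0 < g x := by
      by_contra h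
      push Not at h
      have := hleast ⟨⟨hx.1.le, hx.2.le.trans hx0.1.2⟩, h⟩
      linarith [hx.2]
    have := hx.1
    rw [hHg]; positivity
  have hx02 : x0 ^ 2 ≤ n * (n + 1) := by
    have : x0 ^ 2 ≤ z ^ 2 := by
      have := hx0.1.2
      gcongr
    linarith
  have hm := (besHP_mono hn hx0p.le hx02 (fun x hx => (hpos x hx).le)).1
  have h1 := hm (a := x0 / 2) (b := x0) ⟨by linarith, by linarith⟩ ⟨hx0p.le, le_rfl⟩ (by linarith)
  have h2 := hpos (x0 / 2) ⟨by linarith, by linarith⟩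
  have h3 : besH n x0 ≤ 0 := by
    rw [hHg]
    exact mul_nonpos_of_nonneg_of_nonpos (by positivity) hx0.2
  linarith

lemma besHP {n : ℕ} (hn : 1 ≤ n) {b : ℝ} (hb : 0 ≤ b) (hb2 : b ^ 2 ≤ n * (n + 1)) :
    MonotoneOn (besH n) (Set.Icc 0 b) ∧ ∀ x ∈ Set.Icc 0 b, 0 ≤ besP n x := by
  refine besHP_mono hn hb hb2 ?_
  intro x hx
  refine (besH_pos hn hx.1 ?_).le
  have : x ^ 2 ≤ b ^ 2 := by
    have := hx.1; have := hx.2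
    gcongr
  linarith

lemma bes_growth {n : ℕ} (hn : 1 ≤ n) {a b m : ℝ} (ha : 0 < a) (hab : a ≤ b)
    (hb2 : b ^ 2 ≤ n * (n + 1))
    (hq : ∀ x ∈ Set.Icc a b, m ^ 2 ≤ n * (n + 1) / x ^ 2 - 1) :
    a * besH n a * Real.cosh (m * (b - a)) ≤ b * besH n b := by
  have hlin : ∀ x : ℝ, HasDerivAt (fun x => m * (x - a)) m x := by
    intro x
    have := ((hasDerivAt_id x).sub_const a).const_mul m
    simpa using this
  have hc : ∀ x : ℝ, HasDerivAt (fun x => Real.cosh (m * (x - a)))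
      (Real.sinh (m * (x - a)) * m) x := fun x => (hlin x).cosh
  have hs : ∀ x : ℝ, HasDerivAt (fun x => Real.sinh (m * (x - a)))
      (Real.cosh (m * (x - a)) * m) x := fun x => (hlin x).sinh
  set W : ℝ → ℝ := fun x => besV n x * Real.cosh (m * (x - a))
    - (x * besH n x) * (Real.sinh (m * (x - a)) * m) with hW
  have hWd : ∀ x, x ≠ 0 → HasDerivAt W
      ((n * (n + 1) / x ^ 2 - 1 - m ^ 2) * (x * besH n x) * Real.cosh (m * (x - a))) x := by
    intro x hx
    have := ((besV_hasDerivAt hn hx).mul (hc x)).sub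
      ((besU_hasDerivAt hn x).mul ((hs x).mul_const m))
    refine this.congr_deriv ?_
    ring
  have hHp : ∀ x ∈ Set.Icc a b, 0 < besH n x := by
    intro x hx
    have hx0 : 0 < x := lt_of_lt_of_le ha hx.1
    refine besH_pos hn hx0 ?_
    have : x ^ 2 ≤ b ^ 2 := by
      have := hx.2
      gcongr
    linarith
  have hWm : MonotoneOn W (Set.Icc a b) := by
    refine monotoneOn_of_hasDerivWithinAt_nonneg (convex_Icc a b)
      (f' := fun x => (n * (n + 1) / x ^ 2 - 1 - m ^ 2) * (x * besH n x) * Real.cosh (m * (x - a)))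
      (fun x hx => (hWd x (lt_of_lt_of_le ha hx.1).ne').continuousAt.continuousWithinAt)
      (fun x hx => (hWd x (lt_of_lt_of_le ha (interior_subset hx).1).ne').hasDerivWithinAt) ?_
    intro x hx
    have hx := interior_subset hx
    have h1 := hq x hx
    have h2 := hHp x hx
    have hx0 : 0 < x := lt_of_lt_of_le ha hx.1
    have h3 := Real.cosh_pos (m * (x - a))
    have : 0 ≤ n * (n + 1) / x ^ 2 - 1 - m ^ 2 := by linarith
    positivity
  have hWa : 0 ≤ W a := by
    have e : W a = besV n a := by simp [hW]
    have e2 : besV n a * a = a * besH n a + besP n a := by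
      unfold besV besH besP; ring
    have hPa := (besHP hn (ha.le.trans hab) hb2).2 a ⟨ha.le, hab⟩
    have hHa := hHp a ⟨le_rfl, hab⟩
    rw [e]
    by_contra h
    push Not at h
    have := mul_neg_of_neg_of_pos h ha
    have := mul_pos ha hHa
    linarith
  have hWn : ∀ x ∈ Set.Icc a b, 0 ≤ W x := fun x hx =>
    hWa.trans (hWm ⟨le_rfl, hab⟩ hx hx.1)
  have hd : ∀ x : ℝ, HasDerivAt (fun x => (x * besH n x) / Real.cosh (m * (x - a)))
      (W x / Real.cosh (m * (x - a)) ^ 2) x := fun x =>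
    (besU_hasDerivAt hn x).div (hc x) (Real.cosh_pos _).ne'
  have hfm : MonotoneOn (fun x => (x * besH n x) / Real.cosh (m * (x - a))) (Set.Icc a b) :=
    monotoneOn_of_hasDerivWithinAt_nonneg (convex_Icc a b)
      (f' := fun x => W x / Real.cosh (m * (x - a)) ^ 2)
      (fun x hx => (hd x).continuousAt.continuousWithinAt)
      (fun x hx => (hd x).hasDerivWithinAt)
      (fun x hx => div_nonneg (hWn x (interior_subset hx)) (by positivity))
  have := hfm ⟨le_rfl, hab⟩ ⟨hab, le_rfl⟩ hab
  simp only [sub_self, mul_zero, Real.cosh_zero, div_one] at this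
  rwa [le_div_iff₀ (Real.cosh_pos _)] at this

lemma bes_sturm {n : ℕ} (hn : 1 ≤ n) {a m σ : ℝ} (ha : 0 < a) (hm : 0 < m)
    (hq : ∀ x, a ≤ x → n * (n + 1) / x ^ 2 - 1 ≤ - m ^ 2)
    (hpos : ∀ x ∈ Set.Icc a (a + π / m), 0 < σ * besH n x) : False := by
  have hL : 0 < π / m := by positivity
  have hlin : ∀ x : ℝ, HasDerivAt (fun x => m * (x - a)) m x := by
    intro x
    have := ((hasDerivAt_id x).sub_const a).const_mul m
    simpa using this
  have hc : ∀ x : ℝ, HasDerivAt (fun x => Real.cos (m * (x - a)))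
      (-Real.sin (m * (x - a)) * m) x := fun x => (hlin x).cos
  have hs : ∀ x : ℝ, HasDerivAt (fun x => Real.sin (m * (x - a)))
      (Real.cos (m * (x - a)) * m) x := fun x => (hlin x).sin
  set W : ℝ → ℝ := fun x => σ * (besV n x * Real.sin (m * (x - a))
    - (x * besH n x) * (Real.cos (m * (x - a)) * m)) with hW
  have hWd : ∀ x, x ≠ 0 → HasDerivAt W
      ((n * (n + 1) / x ^ 2 - 1 + m ^ 2) * (x * (σ * besH n x)) * Real.sin (m * (x - a))) x := by
    intro x hx
    have := (((besV_hasDerivAt hn hx).mul (hs x)).sub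
      ((besU_hasDerivAt hn x).mul ((hc x).mul_const m))).const_mul σ
    refine this.congr_deriv ?_
    ring
  have hWm : AntitoneOn W (Set.Icc a (a + π / m)) := by
    refine antitoneOn_of_hasDerivWithinAt_nonpos (convex_Icc a _)
      (f' := fun x => (n * (n + 1) / x ^ 2 - 1 + m ^ 2) * (x * (σ * besH n x))
        * Real.sin (m * (x - a)))
      (fun x hx => (hWd x (lt_of_lt_of_le ha hx.1).ne').continuousAt.continuousWithinAt)
      (fun x hx => (hWd x (lt_of_lt_of_le ha (interior_subset hx).1).ne').hasDerivWithinAt) ?_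
    intro x hx
    have hx := interior_subset hx
    have h1 := hq x hx.1
    have h2 := hpos x hx
    have hx0 : 0 < x := lt_of_lt_of_le ha hx.1
    have h3 : 0 ≤ Real.sin (m * (x - a)) := by
      apply Real.sin_nonneg_of_nonneg_of_le_pi
      · exact mul_nonneg hm.le (by linarith [hx.1])
      · have h4 : x - a ≤ π / m := by linarith [hx.2]
        rw [le_div_iff₀ hm] at h4
        linarith
    have h5 : n * (n + 1) / x ^ 2 - 1 + m ^ 2 ≤ 0 := by linarith
    exact mul_nonpos_of_nonpos_of_nonneg
      (mul_nonpos_of_nonpos_of_nonneg h5 (by positivity)) h3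
  have h := hWm (a := a) (b := a + π / m) ⟨le_rfl, by linarith⟩ ⟨by linarith, le_rfl⟩ (by linarith)
  have ea : W a = - (m * a * (σ * besH n a)) := by simp [hW]; ring
  have eb : W (a + π / m) = m * (a + π / m) * (σ * besH n (a + π / m)) := by
    have : m * (a + π / m - a) = π := by field_simp; ring
    simp only [hW, this, Real.sin_pi, Real.cos_pi]; ring
  have p1 := hpos a ⟨le_rfl, by linarith⟩
  have p2 := hpos (a + π / m) ⟨by linarith, le_rfl⟩
  rw [ea, eb] at h
  have : 0 < m * a * (σ * besH n a) := by positivity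
  have : 0 < m * (a + π / m) * (σ * besH n (a + π / m)) := by positivity
  linarith

lemma bes_exists_zero {n : ℕ} (hn : 1 ≤ n) {a m : ℝ} (ha : 0 < a) (hm : 0 < m)
    (hq : ∀ x, a ≤ x → n * (n + 1) / x ^ 2 - 1 ≤ - m ^ 2) :
    ∃ x ∈ Set.Icc a (a + π / m), besH n x = 0 := by
  by_contra hcon
  push Not at hcon
  have hL : 0 < π / m := by positivity
  have haI : a ∈ Set.Icc a (a + π / m) := ⟨le_rfl, by linarith⟩
  have hpre : IsPreconnected (Set.Icc a (a + π / m)) := isPreconnected_Icc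
  rcases lt_or_gt_of_ne (hcon a haI) with h | h
  · refine bes_sturm hn (σ := -1) ha hm hq ?_
    intro x hx
    by_contra h2
    obtain ⟨y, hy, hy0⟩ := hpre.intermediate_value haI hx (besH_continuous hn).continuousOn
      (show (0 : ℝ) ∈ Set.Icc (besH n a) (besH n x) from ⟨h.le, by linarith⟩)
    exact hcon y hy hy0
  · refine bes_sturm hn (σ := 1) ha hm hq ?_
    intro x hx
    by_contra h2
    obtain ⟨y, hy, hy0⟩ := hpre.intermediate_value hx haI (besH_continuous hn).continuousOn
      (show (0 : ℝ) ∈ Set.Icc (besH n x) (besH n a) from ⟨by linarith, h.le⟩)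
    exact hcon y hy hy0

lemma sbesselJ_zero_iff {n : ℕ} (hn : 1 ≤ n) {z : ℝ} (hz : 0 ≤ z) :
    sbesselJ n z = 0 ↔ besH n z = 0 := by
  rw [sbesselJ_eq hn hz]
  have : 0 < Real.sqrt π / 2 / 2 ^ n := by have := Real.pi_pos; positivity
  simp only [mul_eq_zero, this.ne', false_or]

lemma zero_gt {n : ℕ} (hn : 1 ≤ n) {α : ℝ} (hα : 0 < α) (h : besH n α = 0) : (n : ℝ) < α := by
  by_contra h2
  push Not at h2
  have : α ^ 2 ≤ n * (n + 1) := by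
    have : α ^ 2 ≤ (n : ℝ) ^ 2 := by gcongr
    have : (0 : ℝ) ≤ n := Nat.cast_nonneg n
    nlinarith
  have := besH_pos hn hα this
  linarith

lemma core_decay {n : ℕ} (hn : 1 ≤ n) {c : ℝ} (hc : 4 ≤ c) (hcn : c ^ 3 = (n : ℝ) + 1 / 2) :
    besH n (c ^ 3 - c ^ 2) ≤
      4 * Real.exp (-(1 / 3) * c) * besH n (c ^ 3 - c ^ 2 + c ^ 2 / 4) := by
  have hs : 3 * c ^ 2 ≤ c ^ 3 - c ^ 2 := by nlinarith [sq_nonneg c]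
  have hc2 : 16 ≤ c ^ 2 := by nlinarith
  have hnn : (n : ℝ) * (n + 1) = c ^ 6 - 1 / 4 := by
    have : c ^ 6 = (c ^ 3) ^ 2 := by ring
    rw [this, hcn]; ring
  have hb2 : (c ^ 3 - c ^ 2 + c ^ 2 / 4) ^ 2 * (1 + (4 / (3 * c)) ^ 2) ≤ n * (n + 1) := by
    rw [hnn]
    have e : (c ^ 3 - c ^ 2 + c ^ 2 / 4) ^ 2 * (1 + (4 / (3 * c)) ^ 2) =
      (c ^ 3 - c ^ 2 + c ^ 2 / 4) ^ 2 + 16 / 9 * c ^ 2 * (c - 3 / 4) ^ 2 := by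
      field_simp; ring
    rw [e]
    have h1 : c ^ 2 * (c - 3 / 4) ^ 2 ≤ c ^ 2 * c ^ 2 := by
      apply mul_le_mul_of_nonneg_left _ (by positivity)
      apply pow_le_pow_left₀ <;> linarith
    have h4 : 256 ≤ c ^ 4 := by nlinarith
    have h5 : c ^ 4 * 4 ≤ c ^ 4 * c := by gcongr
    nlinarith
  set s := c ^ 3 - c ^ 2 with hsdef
  set b := c ^ 3 - c ^ 2 + c ^ 2 / 4 with hbdef
  have hs0 : 0 < s := by linarith
  have hsb : s ≤ b := by simp only [hbdef, hsdef]; linarith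
  have hb0 : 0 < b := by linarith
  have hbn : b ^ 2 ≤ n * (n + 1) := by
    have : 0 ≤ b ^ 2 * (4 / (3 * c)) ^ 2 := by positivity
    nlinarith
  have hg := bes_growth hn (m := 4 / (3 * c)) hs0 hsb hbn (by
    intro x hx
    have hx0 : 0 < x := lt_of_lt_of_le hs0 hx.1
    rw [le_sub_iff_add_le, le_div_iff₀ (by positivity)]
    have h1 : x ^ 2 ≤ b ^ 2 := by
      have := hx.2
      gcongr
    have h2 : x ^ 2 * (1 + (4 / (3 * c)) ^ 2) ≤ b ^ 2 * (1 + (4 / (3 * c)) ^ 2) := by gcongr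
    linarith)
  have harg : 4 / (3 * c) * (b - s) = 1 / 3 * c := by
    simp only [hbdef, hsdef]; field_simp; ring
  rw [harg] at hg
  have hcosh : Real.exp (1 / 3 * c) / 2 ≤ Real.cosh (1 / 3 * c) := by
    rw [Real.cosh_eq]
    have := Real.exp_pos (-(1 / 3 * c))
    linarith
  have hHs : 0 < besH n s := besH_pos hn hs0 (by
    have : s ^ 2 ≤ b ^ 2 := by gcongr
    linarith)
  have hHb : 0 < besH n b := besH_pos hn hb0 hbn
  have hb2s : b ≤ 2 * s := by simp only [hbdef]; linarith
  have h1 : s * besH n s * (Real.exp (1 / 3 * c) / 2) ≤ 2 * s * besH n b := by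
    calc _ ≤ s * besH n s * Real.cosh (1 / 3 * c) := by gcongr
      _ ≤ b * besH n b := hg
      _ ≤ _ := by gcongr
  have h2 : besH n s * Real.exp (1 / 3 * c) ≤ 4 * besH n b := by
    have : s * (besH n s * Real.exp (1 / 3 * c)) ≤ s * (4 * besH n b) := by linarith
    exact le_of_mul_le_mul_left this hs0
  have h3 : Real.exp (-(1 / 3) * c) = (Real.exp (1 / 3 * c))⁻¹ := by
    rw [← Real.exp_neg]; ring_nf
  rw [h3]
  rw [← le_div_iff₀ (Real.exp_pos _)] at h2
  calc _ ≤ _ := h2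
    _ = _ := by ring

lemma core_ratio {n : ℕ} (hn : 1 ≤ n) {c p α : ℝ} (hp : 1 ≤ p) (hc : 4 ≤ c)
    (hcn : c ^ 3 = (n : ℝ) + 1 / 2) (hα : (n : ℝ) < α) :
    0 ≤ (∫ z in (0 : ℝ)..(c ^ 3 - c ^ 2), z ^ 2 * |sbesselJ n z| ^ p) /
      (∫ z in (0 : ℝ)..α, z ^ 2 * |sbesselJ n z| ^ p) ∧
    (∫ z in (0 : ℝ)..(c ^ 3 - c ^ 2), z ^ 2 * |sbesselJ n z| ^ p) /
      (∫ z in (0 : ℝ)..α, z ^ 2 * |sbesselJ n z| ^ p) ≤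
        4 * c * (4 * Real.exp (-(1 / 3) * c)) ^ p := by
  have hp0 : 0 < p := by linarith
  have hdec := core_decay hn hc hcn
  have hs : 3 * c ^ 2 ≤ c ^ 3 - c ^ 2 := by nlinarith [sq_nonneg c]
  have hc2 : 16 ≤ c ^ 2 := by nlinarith
  have hα0 : 0 < α := lt_of_le_of_lt (Nat.cast_nonneg n) hα
  set κ : ℝ := Real.sqrt π / 2 / 2 ^ n with hκ
  have hκ0 : 0 < κ := by have := Real.pi_pos; positivity
  set f : ℝ → ℝ := fun z => z ^ 2 * |sbesselJ n z| ^ p with hf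
  have hfe : ∀ z, 0 ≤ z → f z = z ^ 2 * |κ * besH n z| ^ p := by
    intro z hz
    simp only [hf, sbesselJ_eq hn hz, hκ]
  have hcont : Continuous (fun z => z ^ 2 * |κ * besH n z| ^ p) :=
    (continuous_pow 2).mul
      (((continuous_const.mul (besH_continuous hn)).abs).rpow_const (fun _ => Or.inr hp0.le))
  have hint : ∀ a b : ℝ, 0 ≤ a → a ≤ b → IntervalIntegrable f volume a b := by
    intro a b ha hab
    refine (ContinuousOn.congr (hcont.continuousOn (s := Set.uIcc a b)) ?_).intervalIntegrable
    intro z hz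
    rw [Set.uIcc_of_le hab] at hz
    exact hfe z (ha.trans hz.1)
  have hf0 : ∀ z, 0 ≤ f z := fun z => by simp only [hf]; positivity
  set s := c ^ 3 - c ^ 2 with hsdef
  have hs0 : 0 < s := by linarith
  set b := s + c ^ 2 / 4 with hbdef
  set d := s + c ^ 2 / 2 with hddef
  have hsb : s ≤ b := by simp only [hbdef]; linarith
  have hbd : b ≤ d := by simp only [hbdef, hddef]; linarith
  have hdn : d ≤ n := by simp only [hddef, hsdef]; linarith
  have hd2 : d ^ 2 ≤ n * (n + 1) := by
    have : d ^ 2 ≤ (n : ℝ) ^ 2 := by gcongr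
    nlinarith
  obtain ⟨hmono, -⟩ := besHP hn (by linarith : 0 ≤ d) hd2
  have hHpos : ∀ x, 0 < x → x ≤ d → 0 < besH n x := by
    intro x hx hxd
    refine besH_pos hn hx ?_
    have : x ^ 2 ≤ d ^ 2 := by gcongr
    linarith
  have hHs := hHpos s hs0 (hsb.trans hbd)
  have hHb := hHpos b (by linarith) hbd
  have hnum : ∫ z in (0 : ℝ)..s, f z ≤ s * (s ^ 2 * (κ * besH n s) ^ p) := by
    have h := intervalIntegral.integral_mono_on (μ := volume) hs0.le (hint 0 s le_rfl hs0.le)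
      (intervalIntegrable_const (c := s ^ 2 * (κ * besH n s) ^ p)) (by
        intro x hx
        rw [hfe x hx.1]
        have hHx : 0 ≤ besH n x := by
          have := hmono (a := 0) (b := x) ⟨le_rfl, by linarith⟩ ⟨hx.1, by linarith [hx.2]⟩ hx.1
          have e : besH n 0 = 0 := by simp [besH, Nat.one_le_iff_ne_zero.1 hn]
          linarith
        rw [abs_of_nonneg (by positivity)]
        have h1 : besH n x ≤ besH n s :=
          hmono ⟨hx.1, by linarith [hx.2]⟩ ⟨hs0.le, by linarith⟩ hx.2
        have := hx.1
        have := hx.2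
        gcongr)
    rw [intervalIntegral.integral_const] at h
    simpa using h
  have hden1 : ∫ z in b..d, f z ≤ ∫ z in (0 : ℝ)..α, f z :=
    intervalIntegral.integral_mono_interval (by linarith) hbd (by linarith)
      (Eventually.of_forall hf0) (hint 0 α le_rfl hα0.le)
  have hden2 : (c ^ 2 / 4) * (s ^ 2 * (κ * besH n b) ^ p) ≤ ∫ z in b..d, f z := by
    have h := intervalIntegral.integral_mono_on (μ := volume) hbd
      (intervalIntegrable_const (c := s ^ 2 * (κ * besH n b) ^ p))
      (hint b d (by linarith) hbd) (by
        intro x hx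
        have hx0 : 0 < x := by linarith [hx.1]
        rw [hfe x hx0.le]
        have h1 : besH n b ≤ besH n x :=
          hmono ⟨by linarith, hbd⟩ ⟨hx0.le, hx.2⟩ hx.1
        have hHx : 0 ≤ besH n x := by linarith
        rw [abs_of_nonneg (by positivity)]
        have : s ≤ x := by linarith [hx.1]
        gcongr)
    rw [intervalIntegral.integral_const, smul_eq_mul] at h
    have e : d - b = c ^ 2 / 4 := by simp only [hddef, hbdef]; ring
    rwa [e] at h
  have hBp : 0 < (κ * besH n b) ^ p := Real.rpow_pos_of_pos (by positivity) p
  have hden : (c ^ 2 / 4) * (s ^ 2 * (κ * besH n b) ^ p) ≤ ∫ z in (0 : ℝ)..α, f z :=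
    hden2.trans hden1
  have hD0 : 0 < (c ^ 2 / 4) * (s ^ 2 * (κ * besH n b) ^ p) := by positivity
  have hN0 : 0 ≤ ∫ z in (0 : ℝ)..s, f z :=
    intervalIntegral.integral_nonneg hs0.le (fun z _ => hf0 z)
  refine ⟨div_nonneg hN0 (hD0.le.trans hden), ?_⟩
  rw [div_le_iff₀ (lt_of_lt_of_le hD0 hden)]
  have hA : (κ * besH n s) ^ p ≤ (4 * Real.exp (-(1 / 3) * c)) ^ p * (κ * besH n b) ^ p := by
    rw [← Real.mul_rpow (by positivity) (by positivity)]
    apply Real.rpow_le_rpow (by positivity) _ hp0.le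
    calc κ * besH n s ≤ κ * (4 * Real.exp (-(1 / 3) * c) * besH n b) := by gcongr
      _ = _ := by ring
  have hsc : s ≤ c ^ 3 := by simp only [hsdef]; linarith
  have hE : 0 < (4 * Real.exp (-(1 / 3) * c)) ^ p :=
    Real.rpow_pos_of_pos (by have := Real.exp_pos (-(1 / 3) * c); positivity) p
  have hcpos : 0 < c := by linarith
  calc ∫ z in (0 : ℝ)..s, f z ≤ s * (s ^ 2 * (κ * besH n s) ^ p) := hnum
    _ ≤ c ^ 3 * (s ^ 2 * ((4 * Real.exp (-(1 / 3) * c)) ^ p * (κ * besH n b) ^ p)) := by gcongr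
    _ = 4 * c * (4 * Real.exp (-(1 / 3) * c)) ^ p *
          ((c ^ 2 / 4) * (s ^ 2 * (κ * besH n b) ^ p)) := by ring
    _ ≤ _ := by gcongr

lemma nu_tendsto : Tendsto (fun n : ℕ => (n : ℝ) + 1 / 2) atTop atTop :=
  tendsto_atTop_add_const_right _ _ tendsto_natCast_atTop_atTop

lemma ratio_bound {p : ℝ} (hp : 1 ≤ p) : ∀ᶠ n : ℕ in atTop, ∀ α : ℝ, 0 < α → sbesselJ n α = 0 →
    0 ≤ ballRatio p n α ∧ ballRatio p n α <
      17 * ((n : ℝ) + 1 / 2) ^ ((1 : ℝ) / 3 + 2 / (3 * p)) *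
        Real.exp (-(1 / 3) * ((n : ℝ) + 1 / 2) ^ ((1 : ℝ) / 3)) := by
  have h4 := ((tendsto_rpow_atTop (y := (1 : ℝ) / 3) (by norm_num)).comp
    nu_tendsto).eventually_ge_atTop 4
  filter_upwards [h4, eventually_ge_atTop 1] with n hc hn α hα hz
  simp only [Function.comp_apply] at hc
  have hν : 1 ≤ (n : ℝ) + 1 / 2 := nu_one_le hn
  have hν0 : 0 ≤ (n : ℝ) + 1 / 2 := by linarith
  have hp0 : 0 < p := by linarith
  set c : ℝ := ((n : ℝ) + 1 / 2) ^ ((1 : ℝ) / 3) with hcdef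
  have hc3 : c ^ 3 = (n : ℝ) + 1 / 2 := by
    rw [hcdef, ← Real.rpow_mul_natCast hν0]; norm_num
  have hc2 : c ^ 2 = ((n : ℝ) + 1 / 2) ^ ((2 : ℝ) / 3) := by
    rw [hcdef, ← Real.rpow_mul_natCast hν0]; norm_num
  have hse : sseq n = c ^ 3 - c ^ 2 := by rw [sseq, hc3, hc2]
  have hαn := zero_gt hn hα ((sbesselJ_zero_iff hn hα.le).1 hz)
  obtain ⟨r0, r1⟩ := core_ratio hn hp hc hc3 hαn
  unfold ballRatio
  rw [hse]
  refine ⟨Real.rpow_nonneg r0 _, ?_⟩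
  have hE := Real.exp_pos (-(1 / 3) * c)
  have hc0 : 0 < c := by linarith
  have h1p : 1 / p ≤ 1 := by rw [div_le_one hp0]; exact hp
  have hX : 1 ≤ ((n : ℝ) + 1 / 2) ^ ((1 : ℝ) / 3 + 2 / (3 * p)) :=
    Real.one_le_rpow hν (by positivity)
  calc _ ≤ (4 * c * (4 * Real.exp (-(1 / 3) * c)) ^ p) ^ (1 / p) :=
        Real.rpow_le_rpow r0 r1 (by positivity)
    _ = 4 ^ (1 / p) * c ^ (1 / p) * (4 * Real.exp (-(1 / 3) * c)) := by
        rw [Real.mul_rpow (by positivity) (by positivity), ← Real.rpow_mul (by positivity),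
          mul_one_div_cancel hp0.ne', Real.rpow_one, Real.mul_rpow (by positivity) hc0.le]
    _ ≤ 4 * ((n : ℝ) + 1 / 2) ^ ((1 : ℝ) / 3 + 2 / (3 * p)) *
          (4 * Real.exp (-(1 / 3) * c)) := by
        gcongr
        · calc (4 : ℝ) ^ (1 / p) ≤ 4 ^ (1 : ℝ) :=
              Real.rpow_le_rpow_of_exponent_le (by norm_num) h1p
            _ = 4 := by norm_num
        · rw [hcdef, ← Real.rpow_mul hν0]
          apply Real.rpow_le_rpow_of_exponent_le hν
          have : 0 ≤ 2 / (3 * p) := by positivity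
          nlinarith
    _ < _ := by
        have : 0 < ((n : ℝ) + 1 / 2) ^ ((1 : ℝ) / 3 + 2 / (3 * p)) * Real.exp (-(1 / 3) * c) := by
          positivity
        nlinarith

lemma bound_tendsto (a : ℝ) : Tendsto (fun n : ℕ => 17 * ((n : ℝ) + 1 / 2) ^ a *
        Real.exp (-(1 / 3) * ((n : ℝ) + 1 / 2) ^ ((1 : ℝ) / 3))) atTop (𝓝 0) := by
  have h1 : Tendsto (fun n : ℕ => ((n : ℝ) + 1 / 2) ^ ((1 : ℝ) / 3)) atTop atTop :=
    (tendsto_rpow_atTop (y := (1 : ℝ) / 3) (by norm_num)).comp nu_tendsto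
  have h2 := ((tendsto_rpow_mul_exp_neg_mul_atTop_nhds_zero (3 * a) (1 / 3) (by norm_num)).comp
    h1).const_mul 17
  rw [mul_zero] at h2
  refine h2.congr ?_
  intro n
  have hν0 : 0 ≤ (n : ℝ) + 1 / 2 := by positivity
  simp only [Function.comp_apply]
  rw [← Real.rpow_mul hν0]
  have : (1 : ℝ) / 3 * (3 * a) = a := by ring
  rw [this, mul_assoc]

lemma gamma_upper (γ : ℕ → ℕ → ℝ)
    (hγ_pos : ∀ (n k : ℕ), 1 ≤ k → 0 < γ n k)
    (hγ_mono : ∀ (n k l : ℕ), 1 ≤ k → k < l → γ n k < γ n l)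
    (hγ_surj : ∀ (n : ℕ) (x : ℝ), 0 < x → sbesselJ n x = 0 → ∃ k, 1 ≤ k ∧ γ n k = x)
    {n : ℕ} (hn : 1 ≤ n) {a m : ℝ} (ha : 0 < a) (hm : 0 < m)
    (hq : ∀ x, a ≤ x → n * (n + 1) / x ^ 2 - 1 ≤ - m ^ 2) (k : ℕ) (hk : 1 ≤ k) :
    γ n k ≤ a + k * (π / m + 1) := by
  have hL : 0 < π / m := by have := Real.pi_pos; positivity
  have hle : ∀ k l, 1 ≤ k → k ≤ l → γ n k ≤ γ n l := by
    intro k l h1 h2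
    rcases h2.eq_or_lt with rfl | h2
    · exact le_rfl
    · exact (hγ_mono n k l h1 h2).le
  induction k, hk using Nat.le_induction with
  | base =>
    obtain ⟨x, hx, hx0⟩ := bes_exists_zero hn ha hm hq
    have hxp : 0 < x := lt_of_lt_of_le ha hx.1
    obtain ⟨l, hl, rfl⟩ := hγ_surj n x hxp ((sbesselJ_zero_iff hn hxp.le).2 hx0)
    have := hle 1 l le_rfl hl
    have := hx.2
    push_cast
    linarith
  | succ k hk ih =>
    set M := max (γ n k) a with hM
    have hMa : a ≤ M := le_max_right _ _
    have hMk : γ n k ≤ M := le_max_left _ _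
    have hMu : M ≤ a + k * (π / m + 1) := max_le ih (by
      have : 0 ≤ (k : ℝ) * (π / m + 1) := by positivity
      linarith)
    obtain ⟨x, hx, hx0⟩ := bes_exists_zero hn (a := M + 1) (by linarith) hm
      (fun y hy => hq y (by linarith))
    have hxp : 0 < x := by linarith [hx.1]
    obtain ⟨l, hl, rfl⟩ := hγ_surj n x hxp ((sbesselJ_zero_iff hn hxp.le).2 hx0)
    have hkl : k + 1 ≤ l := by
      by_contra h
      have := hle l k hl (by omega)
      linarith [hx.1]
    have := hle (k + 1) l (by omega) hkl
    have := hx.2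
    push_cast
    linarith

lemma gamma_tendsto (γ : ℕ → ℕ → ℝ)
    (hγ_pos : ∀ (n k : ℕ), 1 ≤ k → 0 < γ n k)
    (hγ_zero : ∀ (n k : ℕ), 1 ≤ k → sbesselJ n (γ n k) = 0)
    (hγ_mono : ∀ (n k l : ℕ), 1 ≤ k → k < l → γ n k < γ n l)
    (hγ_surj : ∀ (n : ℕ) (x : ℝ), 0 < x → sbesselJ n x = 0 → ∃ k, 1 ≤ k ∧ γ n k = x)
    (k : ℕ) (hk : 1 ≤ k) :
    Tendsto (fun n : ℕ => γ n k / ((n : ℝ) + 1 / 2)) atTop (𝓝 1) := by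
  rw [tendsto_order]
  constructor
  · intro a ha
    have h := nu_tendsto.eventually_gt_atTop (1 / (1 - a))
    filter_upwards [h, eventually_ge_atTop 1] with n h1 hn
    have hν := nu_one_le hn
    have := zero_gt hn (hγ_pos n k hk) ((sbesselJ_zero_iff hn (hγ_pos n k hk).le).1 (hγ_zero n k hk))
    rw [lt_div_iff₀ (by linarith)]
    rw [div_lt_iff₀ (by linarith)] at h1
    nlinarith
  · intro b hb
    set t : ℝ := (b + 1) / 2 with ht
    have ht1 : 1 < t := by simp only [ht]; linarith
    have htb : t < b := by simp only [ht]; linarith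
    have hm2 : 0 < 1 - 1 / t ^ 2 := by
      have : 1 / t ^ 2 < 1 := by
        rw [div_lt_one (by positivity)]; nlinarith
      linarith
    set m := Real.sqrt (1 - 1 / t ^ 2) with hm
    have hm0 : 0 < m := Real.sqrt_pos.2 hm2
    have hmsq : m ^ 2 = 1 - 1 / t ^ 2 := Real.sq_sqrt hm2.le
    have h := nu_tendsto.eventually_gt_atTop (k * (π / m + 1) / (b - t))
    filter_upwards [h, eventually_ge_atTop 1] with n h1 hn
    have hν := nu_one_le hn
    have hu := gamma_upper γ hγ_pos hγ_mono hγ_surj hn (a := t * ((n : ℝ) + 1 / 2))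
      (by positivity) hm0 (by
        intro x hx
        rw [hmsq]
        have hx0 : 0 < x := lt_of_lt_of_le (by positivity) hx
        have h2 : (t * ((n : ℝ) + 1 / 2)) ^ 2 ≤ x ^ 2 := by gcongr
        have h3 : (n : ℝ) * (n + 1) / x ^ 2 ≤ 1 / t ^ 2 := by
          rw [div_le_div_iff₀ (by positivity) (by positivity)]
          nlinarith [sq_nonneg t]
        linarith) k hk
    rw [div_lt_iff₀ (by linarith)]
    rw [div_lt_iff₀ (by linarith)] at h1
    nlinarith

lemma sseq_tendsto : Tendsto (fun n : ℕ => sseq n / ((n : ℝ) + 1 / 2)) atTop (𝓝 1) := by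
  have h := ((tendsto_rpow_neg_atTop (y := (1 : ℝ) / 3) (by norm_num)).comp
    nu_tendsto).const_sub 1
  rw [sub_zero] at h
  refine h.congr ?_
  intro n
  have hν0 : 0 < (n : ℝ) + 1 / 2 := by positivity
  simp only [Function.comp_apply, sseq]
  rw [sub_div, div_self hν0.ne']
  congr 1
  nth_rewrite 3 [← Real.rpow_one ((n : ℝ) + 1 / 2)]
  rw [← Real.rpow_sub hν0]
  norm_num

theorem whispering_gallery_ball_dirichlet
    (p : ℝ) (hp : 1 ≤ p)
    (γ : ℕ → ℕ → ℝ)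
    (hγ_pos : ∀ (n k : ℕ), 1 ≤ k → 0 < γ n k)
    (hγ_zero : ∀ (n k : ℕ), 1 ≤ k → sbesselJ n (γ n k) = 0)
    (hγ_mono : ∀ (n k l : ℕ), 1 ≤ k → k < l → γ n k < γ n l)
    (hγ_surj : ∀ (n : ℕ) (x : ℝ), 0 < x → sbesselJ n x = 0 → ∃ k, 1 ≤ k ∧ γ n k = x) :
    (∃ C : ℝ, 0 < C ∧ ∀ᶠ n : ℕ in atTop, ∀ α : ℝ, 0 < α → sbesselJ n α = 0 →
        ballRatio p n α <
          C * ((n : ℝ) + 1 / 2) ^ ((1 : ℝ) / 3 + 2 / (3 * p)) *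
            Real.exp (-(1 / 3) * ((n : ℝ) + 1 / 2) ^ ((1 : ℝ) / 3)))
    ∧ (∀ k : ℕ, 1 ≤ k →
        Tendsto (fun n : ℕ => ballRatio p n (γ n k)) atTop (𝓝 0)
        ∧ Tendsto (fun n : ℕ => (sseq n / γ n k) ^ 3) atTop (𝓝 1)) := by

  refine ⟨⟨17, by norm_num, ?_⟩, ?_⟩
  · filter_upwards [ratio_bound hp] with n h α hα hz
    exact (h α hα hz).2
  · intro k hk
    constructor
    · refine tendsto_of_tendsto_of_tendsto_of_le_of_le' tendsto_const_nhds
        (bound_tendsto ((1 : ℝ) / 3 + 2 / (3 * p))) ?_ ?_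
      · filter_upwards [ratio_bound hp] with n h
        exact (h _ (hγ_pos n k hk) (hγ_zero n k hk)).1
      · filter_upwards [ratio_bound hp] with n h
        exact (h _ (hγ_pos n k hk) (hγ_zero n k hk)).2.le
    · have h := ((sseq_tendsto.div (gamma_tendsto γ hγ_pos hγ_zero hγ_mono hγ_surj k hk)
        one_ne_zero).pow 3)
      rw [div_one, one_pow] at h
      refine h.congr ?_
      intro n
      have hν0 : (n : ℝ) + 1 / 2 ≠ 0 := by positivity
      simp only [Pi.div_apply]
      rw [div_div_div_cancel_right₀ hν0]
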